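/- arXiv:2108.00914 — 9 statements merged into one kernel-verified Lean document; each statement's English description precedes it below -/
import Mathlib

section
/- Let M = (E, r) be a matroid on a finite ground set E with |E| = m, whose rank function satisfies r(E) ≤ k, where 0 ≤ k ≤ m. Then min over bijections σ : E → {1,…,m} of ∑_{i=1}^m r(E_{i,σ}) equals k(k+1)/2 + k(m−k) if and only if M is isomorphic to the uniform matroid U_k^m, i.e., if and only if r(S) = min(|S|, k) for every S ⊆ E. -/
/-- Rank-function axioms for a matroid on ground set `α`: normalized, monotone,
submodular, and with unit increments (these imply `r A ≤ |A|`). -/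
def IsRankFunction {α : Type*} [DecidableEq α] (r : Finset α → ℕ) : Prop :=
  r ∅ = 0 ∧
  (∀ A B : Finset α, A ⊆ B → r A ≤ r B) ∧
  (∀ A B : Finset α, r (A ∪ B) + r (A ∩ B) ≤ r A + r B) ∧
  (∀ (A : Finset α) (e : α), r (insert e A) ≤ r A + 1)

/-- The prefix set `E_{i,σ} = {e : σ(e) ≤ i}`, where the bijection `σ : α ≃ Fin m`
is interpreted as a labeling by `{1,…,m}` via `e ↦ (σ e) + 1`. -/
def prefixSet {α : Type*} [Fintype α] [DecidableEq α] {m : ℕ} (σ : α ≃ Fin m) (i : ℕ) :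
    Finset α :=
  Finset.univ.filter fun e => (σ e : ℕ) < i

theorem IsRankFunction.le_card {α : Type*} [DecidableEq α] {r : Finset α → ℕ}
    (hr : IsRankFunction r) (A : Finset α) : r A ≤ A.card := by
  obtain ⟨h0, -, -, h1⟩ := hr
  induction A using Finset.induction_on with
  | empty => simp [h0]
  | insert e A he ih =>
    rw [Finset.card_insert_of_notMem he]
    exact (h1 A e).trans (Nat.add_le_add_right ih 1)

theorem mem_prefixSet {α : Type*} [Fintype α] [DecidableEq α] {m : ℕ} {σ : α ≃ Fin m}
    {i : ℕ} {x : α} : x ∈ prefixSet σ i ↔ (σ x : ℕ) < i := by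
  simp [prefixSet]

theorem card_prefixSet {α : Type*} [Fintype α] [DecidableEq α] {m : ℕ} (σ : α ≃ Fin m)
    {i : ℕ} (hi : i ≤ m) : (prefixSet σ i).card = i := by
  have h : (prefixSet σ i).map σ.toEmbedding = Finset.univ.filter fun j : Fin m => (j : ℕ) < i := by
    ext j
    simp [mem_prefixSet, Finset.mem_map_equiv]
  rw [← Finset.card_map σ.toEmbedding, h, Fin.card_filter_val_lt, min_eq_right hi]

theorem exists_prefixSet_eq {α : Type*} [Fintype α] [DecidableEq α] {m : ℕ}
    (hm : Fintype.card α = m) (S : Finset α) : ∃ σ : α ≃ Fin m, prefixSet σ S.card = S := by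
  let τ : α ≃ Fin m := Fintype.equivFinOfCardEq hm
  have hS : S.card ≤ m := hm ▸ S.card_le_univ
  have hcard : Fintype.card {x // x ∈ S} = Fintype.card {x // x ∈ prefixSet τ S.card} := by
    simp [card_prefixSet τ hS]
  obtain ⟨f, hf⟩ : ∃ f : Equiv.Perm α, ∀ x, f x ∈ prefixSet τ S.card ↔ x ∈ S :=
    ⟨(Fintype.equivOfCardEq hcard).extendSubtype, fun x =>
      ⟨fun h => by_contra fun hn => Equiv.extendSubtype_not_mem _ x hn h,
        fun h => Equiv.extendSubtype_mem _ x h⟩⟩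
  refine ⟨f.trans τ, Finset.ext fun x => ?_⟩
  rw [← hf x, mem_prefixSet, mem_prefixSet, Equiv.trans_apply]

theorem sum_range_min_succ {m k : ℕ} (hkm : k ≤ m) :
    ∑ i ∈ Finset.range m, min (i + 1) k = k * (k + 1) / 2 + k * (m - k) := by
  induction m, hkm using Nat.le_induction with
  | base =>
    have h : ∑ i ∈ Finset.range k, min (i + 1) k = ∑ i ∈ Finset.range (k + 1), i := by
      rw [Finset.sum_range_succ']
      exact Finset.sum_congr rfl fun i hi => min_eq_left (Finset.mem_range.mp hi)
    rw [h, Finset.sum_range_id]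
    simp [mul_comm]
  | succ n hn ih =>
    rw [Finset.sum_range_succ, ih, min_eq_right (by omega), Nat.succ_sub hn,
      Nat.mul_succ k (n - k), add_assoc]

theorem stmt_0 {α : Type*} [Fintype α] [DecidableEq α] {m k : ℕ}
    (hm : Fintype.card α = m) (r : Finset α → ℕ) (hr : IsRankFunction r)
    (hrk : r Finset.univ ≤ k) (hkm : k ≤ m) :
    IsLeast {v : ℕ | ∃ σ : α ≃ Fin m, v = ∑ i ∈ Finset.range m, r (prefixSet σ (i + 1))}
        (k * (k + 1) / 2 + k * (m - k)) ↔
      ∀ S : Finset α, r S = min S.card k := by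
  rw [← sum_range_min_succ hkm]
  have hcard : ∀ σ : α ≃ Fin m, ∀ i ∈ Finset.range m, (prefixSet σ (i + 1)).card = i + 1 :=
    fun σ i hi => card_prefixSet σ (Finset.mem_range.mp hi)
  constructor
  · rintro ⟨-, hmin⟩ S
    obtain ⟨σ, hσ⟩ := exists_prefixSet_eq hm S
    have hle : ∀ i ∈ Finset.range m, r (prefixSet σ (i + 1)) ≤ min (i + 1) k := fun i hi =>
      le_min ((hr.le_card _).trans_eq (hcard σ i hi))
        ((hr.2.1 _ _ (Finset.subset_univ _)).trans hrk)
    have heq := (Finset.sum_eq_sum_iff_of_le hle).mp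
      ((Finset.sum_le_sum hle).antisymm (hmin ⟨σ, rfl⟩))
    rcases S.eq_empty_or_nonempty with rfl | hne
    · simp [hr.1]
    · have hpos := hne.card_pos
      have hS : S.card ≤ m := hm ▸ S.card_le_univ
      have h := heq (S.card - 1) (Finset.mem_range.mpr (by omega))
      rwa [Nat.sub_add_cancel hpos, hσ] at h
  · intro h
    have hsum : ∀ σ : α ≃ Fin m, ∑ i ∈ Finset.range m, r (prefixSet σ (i + 1)) =
        ∑ i ∈ Finset.range m, min (i + 1) k := fun σ =>
      Finset.sum_congr rfl fun i hi => by rw [h, hcard σ i hi]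
    refine ⟨⟨Fintype.equivFinOfCardEq hm, (hsum _).symm⟩, ?_⟩
    rintro v ⟨σ, rfl⟩
    exact (hsum σ).ge
end

section
/- Let M = (E, r) be a loopless matroid on a finite ground set E of size m with rank r(E) = k ≥ 1, and let σ : E → {1,…,m} be a bijection minimizing ∑_{i=1}^m r(E_{i,σ}) over all bijections. Then there exist a basis B = {b_1, …, b_k} of M and a partition {X_1, …, X_k} of E into nonempty sets such that: (i) b_i ∈ X_i for each 1 ≤ i ≤ k; (ii) X_1 ∪ ⋯ ∪ X_j is a flat of M for each 1 ≤ j ≤ k; and (iii) σ(e) < σ(e′) whenever e ∈ X_i, e′ ∈ X_l and i < l. -/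
theorem IsRankFunction.insert_le_of_subset {α : Type*} [DecidableEq α] {r : Finset α → ℕ}
    (hr : IsRankFunction r) {S T : Finset α} (hST : S ⊆ T) {e : α} (h : r (insert e S) ≤ r S) :
    r (insert e T) ≤ r T := by
  obtain ⟨-, hmono, hsub, -⟩ := hr
  have h1 := hsub T (insert e S)
  have h2 : r (insert e T) ≤ r (T ∪ insert e S) := hmono _ _ (by grind)
  have h3 : r S ≤ r (T ∩ insert e S) := hmono _ _ (by grind)
  omega

theorem prefixSet_mono {α : Type*} [Fintype α] [DecidableEq α] {m : ℕ} (σ : α ≃ Fin m)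
    {i j : ℕ} (hij : i ≤ j) : prefixSet σ i ⊆ prefixSet σ j := fun _ hx =>
  mem_prefixSet.2 ((mem_prefixSet.1 hx).trans_le hij)

theorem prefixSet_succ {α : Type*} [Fintype α] [DecidableEq α] {m : ℕ} (σ : α ≃ Fin m) (x : α) :
    prefixSet σ (σ x + 1) = insert x (prefixSet σ (σ x)) := by
  ext y
  rw [Finset.mem_insert, mem_prefixSet, mem_prefixSet, Nat.lt_succ_iff_lt_or_eq,
    ← Fin.ext_iff, σ.apply_eq_iff_eq, or_comm]

/-- In an optimal ordering, a prefix followed by a rank increase is a flat: otherwise swapping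
the next element `d` with a spanned element `e` would lower the objective. -/
theorem rank_lt_rank_insert_of_optimal {α : Type*} [Fintype α] [DecidableEq α] {m : ℕ}
    {r : Finset α → ℕ} (hr : IsRankFunction r) {σ : α ≃ Fin m}
    (hopt : ∀ π : α ≃ Fin m,
      ∑ i ∈ Finset.range m, r (prefixSet σ (i + 1)) ≤
        ∑ i ∈ Finset.range m, r (prefixSet π (i + 1)))
    {d e : α} (hd : r (prefixSet σ (σ d)) < r (prefixSet σ (σ d + 1)))
    (he : e ∉ prefixSet σ (σ d)) :
    r (prefixSet σ (σ d)) < r (insert e (prefixSet σ (σ d))) := by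
  by_contra! hle
  rw [mem_prefixSet, not_lt] at he
  let π : α ≃ Fin m := (Equiv.swap d e).trans σ
  have hπ : ∀ x, x ≠ e → x ≠ d → π x = σ x := fun x hxe hxd => by
    simp [π, Equiv.swap_apply_of_ne_of_ne hxd hxe]
  have hπd : π d = σ e := by simp [π]
  have hπe : π e = σ d := by simp [π]
  refine absurd (hopt π) (not_le.2 (Finset.sum_lt_sum (fun i _ => ?_)
    ⟨σ d, Finset.mem_range.2 (σ d).2, ?_⟩))
  · by_cases hi : (σ d : ℕ) ≤ i
    · refine (hr.2.1 _ _ fun x hx => ?_).trans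
        (hr.insert_le_of_subset (prefixSet_mono σ (hi.trans i.le_succ)) hle)
      rw [mem_prefixSet] at hx
      rw [Finset.mem_insert, mem_prefixSet]
      by_cases hxe : x = e
      · exact Or.inl hxe
      · by_cases hxd : x = d
        · subst hxd; right; omega
        · rw [hπ x hxe hxd] at hx; exact Or.inr hx
    · refine hr.2.1 _ _ fun x hx => ?_
      rw [mem_prefixSet] at hx ⊢
      by_cases hxe : x = e
      · subst hxe; rw [hπe] at hx; omega
      · by_cases hxd : x = d
        · subst hxd; rw [hπd] at hx; omega
        · rwa [hπ x hxe hxd] at hx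
  · refine ((hr.2.1 _ _ fun x hx => ?_).trans hle).trans_lt hd
    rw [mem_prefixSet] at hx
    rw [Finset.mem_insert, mem_prefixSet]
    by_cases hxe : x = e
    · exact Or.inl hxe
    · right
      by_cases hxd : x = d
      · subst hxd
        rw [hπd] at hx
        exact absurd (σ.injective (Fin.ext (by omega))) hxe
      · rw [hπ x hxe hxd] at hx
        have : (σ x : ℕ) ≠ σ d := fun h => hxd (σ.injective (Fin.ext h))
        omega

/-- Elements at which the rank of the prefix jumps from `i` to `i + 1` form an independent set. -/
theorem le_rank_image_of_rank_jump {α : Type*} [Fintype α] [DecidableEq α] {m k : ℕ}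
    {r : Finset α → ℕ} (hr : IsRankFunction r) {σ : α ≃ Fin m} {b : Fin k → α}
    (hb : ∀ i, r (prefixSet σ (σ (b i))) = i ∧ r (prefixSet σ (σ (b i) + 1)) = i + 1) :
    k ≤ r (Finset.image b Finset.univ) := by
  obtain ⟨-, hmono, hsub, -⟩ := hr
  have key : ∀ n ≤ k, n ≤ r (Finset.image b (Finset.univ.filter fun i => (i : ℕ) < n)) := by
    intro n
    induction n with
    | zero => simp
    | succ n ih =>
      intro hn
      let c : Fin k := ⟨n, hn⟩
      set A := Finset.image b (Finset.univ.filter fun i => (i : ℕ) < n) with hA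
      have hAP : A ⊆ prefixSet σ (σ (b c)) := by
        intro x hx
        simp only [hA, Finset.mem_image, Finset.mem_filter, Finset.mem_univ, true_and] at hx
        obtain ⟨i, hi, rfl⟩ := hx
        rw [mem_prefixSet]
        by_contra! hle
        have h1 := hmono _ _ (prefixSet_mono σ (Nat.succ_le_succ hle))
        have h2 := (hb c).2
        have h3 := (hb i).2
        simp only [c, Nat.succ_eq_add_one] at h1 h2
        omega
      have h1 := hsub (prefixSet σ (σ (b c))) (insert (b c) A)
      have h2 : r (prefixSet σ (σ (b c) + 1)) ≤
          r (prefixSet σ (σ (b c)) ∪ insert (b c) A) := by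
        rw [prefixSet_succ]
        exact hmono _ _ (by grind)
      have h3 : r A ≤ r (prefixSet σ (σ (b c)) ∩ insert (b c) A) := hmono _ _ (by grind)
      have h4 : r (insert (b c) A) ≤
          r (Finset.image b (Finset.univ.filter fun i => (i : ℕ) < n + 1)) := by
        refine hmono _ _ (Finset.insert_subset ?_ ?_)
        · exact Finset.mem_image_of_mem _ (by simp [c])
        · exact Finset.image_subset_image fun i hi => by
            simp only [Finset.mem_filter, Finset.mem_univ, true_and] at hi ⊢
            omega
      have h5 := (hb c).1
      have h6 := (hb c).2
      have h7 := ih (by omega)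
      simp only [c] at h1 h2 h3 h4 h5 h6
      omega
  exact (key k le_rfl).trans (hmono _ _ (Finset.image_subset_image (Finset.filter_subset _ _)))

/-- Some element raises the rank of the prefix from `j` to `j + 1`, for each `j` below the rank. -/
theorem exists_rank_jump {α : Type*} [Fintype α] [DecidableEq α] {m : ℕ}
    {r : Finset α → ℕ} (hr : IsRankFunction r) (σ : α ≃ Fin m) {j : ℕ}
    (hj : j < r Finset.univ) :
    ∃ x, r (prefixSet σ (σ x)) = j ∧ r (prefixSet σ (σ x + 1)) = j + 1 := by
  have hex : ∃ t, j < r (prefixSet σ t) :=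
    ⟨m, hj.trans_le (hr.2.1 _ _ fun x _ => mem_prefixSet.2 (σ x).2)⟩
  obtain ⟨t, ht, hmin⟩ : ∃ t, j < r (prefixSet σ t) ∧ ∀ s < t, r (prefixSet σ s) ≤ j :=
    ⟨Nat.find hex, Nat.find_spec hex, fun s hs => not_lt.1 (Nat.find_min hex hs)⟩
  cases t with
  | zero => simp [prefixSet, hr.1] at ht
  | succ p =>
    have hle := hmin p p.lt_succ_self
    by_cases hp : p < m
    · have hx : (σ (σ.symm ⟨p, hp⟩) : ℕ) = p := by simp
      have hstep := hr.2.2.2 (prefixSet σ p) (σ.symm ⟨p, hp⟩)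
      have hs := prefixSet_succ σ (σ.symm ⟨p, hp⟩)
      rw [hx] at hs
      rw [← hs] at hstep
      exact ⟨σ.symm ⟨p, hp⟩, by rw [hx]; omega, by rw [hx]; omega⟩
    · have : r (prefixSet σ (p + 1)) ≤ r (prefixSet σ p) :=
        hr.2.1 _ _ fun x _ => mem_prefixSet.2 ((σ x).2.trans_le (not_lt.1 hp))
      omega

theorem stmt_2 {α : Type*} [Fintype α] [DecidableEq α] {m k : ℕ}
    (hm : Fintype.card α = m) (r : Finset α → ℕ) (hr : IsRankFunction r)
    (hloopless : ∀ e : α, r {e} = 1)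
    (hrank : r Finset.univ = k) (hk : 1 ≤ k)
    (σ : α ≃ Fin m)
    (hopt : ∀ π : α ≃ Fin m,
      ∑ i ∈ Finset.range m, r (prefixSet σ (i + 1)) ≤
        ∑ i ∈ Finset.range m, r (prefixSet π (i + 1))) :
    ∃ (b : Fin k → α) (X : Fin k → Finset α),
      -- `B = {b_1, …, b_k}` is a basis
      Function.Injective b ∧
      r (Finset.image b Finset.univ) = k ∧
      -- `{X_1, …, X_k}` is a partition of `E` into nonempty sets
      (∀ i, (X i).Nonempty) ∧
      (∀ i j : Fin k, i ≠ j → Disjoint (X i) (X j)) ∧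
      Finset.univ.biUnion X = Finset.univ ∧
      -- (i) `b_i ∈ X_i`
      (∀ i, b i ∈ X i) ∧
      -- (ii) `X_1 ∪ ⋯ ∪ X_j` is a flat for each `j`
      (∀ j : Fin k, ∀ e ∉ (Finset.univ.filter (· ≤ j)).biUnion X,
        r ((Finset.univ.filter (· ≤ j)).biUnion X) <
          r (insert e ((Finset.univ.filter (· ≤ j)).biUnion X))) ∧
      -- (iii) `σ(e) < σ(e′)` whenever `e ∈ X_i`, `e′ ∈ X_l`, `i < l`
      (∀ i l : Fin k, i < l → ∀ e ∈ X i, ∀ e' ∈ X l, σ e < σ e') := by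
  have hmono : ∀ {i j : ℕ}, i ≤ j → r (prefixSet σ i) ≤ r (prefixSet σ j) :=
    fun hij => hr.2.1 _ _ (prefixSet_mono σ hij)
  have hpos : ∀ e, 1 ≤ r (prefixSet σ (σ e + 1)) := fun e =>
    (hloopless e).symm.le.trans (hr.2.1 _ _ (by simp [prefixSet]))
  have hle : ∀ e, r (prefixSet σ (σ e + 1)) ≤ k := fun e =>
    (hr.2.1 _ _ (Finset.subset_univ _)).trans_eq hrank
  choose b hb using fun i : Fin k => exists_rank_jump hr σ (i.2.trans_eq hrank.symm)
  let X : Fin k → Finset α := fun i =>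
    Finset.univ.filter fun e => r (prefixSet σ (σ e + 1)) = i + 1
  have hX : ∀ {i e}, e ∈ X i ↔ r (prefixSet σ (σ e + 1)) = i + 1 := by simp [X]
  have hbX : ∀ i, b i ∈ X i := fun i => hX.2 (hb i).2
  refine ⟨b, X, fun i j hij => ?_, le_antisymm ?_ (le_rank_image_of_rank_jump hr hb),
    fun i => ⟨b i, hbX i⟩, fun i j hij => ?_, ?_, hbX, fun j e he => ?_,
    fun i l hil e he e' he' => ?_⟩
  · have h := (hb i).2
    rw [hij, (hb j).2] at h
    exact Fin.ext (by omega)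
  · exact (hr.2.1 _ _ (Finset.subset_univ _)).trans_eq hrank
  · refine Finset.disjoint_left.2 fun e hi hj => hij (Fin.ext ?_)
    rw [hX] at hi hj
    omega
  · refine Finset.eq_univ_of_forall fun e => Finset.mem_biUnion.2 ?_
    have h1 := hpos e
    have h2 := hle e
    exact ⟨⟨r (prefixSet σ (σ e + 1)) - 1, by omega⟩, Finset.mem_univ _, hX.2 (by simp; omega)⟩
  · have hU : ∀ x, x ∈ (Finset.univ.filter (· ≤ j)).biUnion X ↔
        r (prefixSet σ (σ x + 1)) ≤ j + 1 := by
      intro x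
      simp only [Finset.mem_biUnion, Finset.mem_filter, Finset.mem_univ, true_and, hX]
      constructor
      · rintro ⟨i, hi, h⟩
        have : (i : ℕ) ≤ j := hi
        omega
      · intro h
        have h1 := hpos x
        have h2 := hle x
        refine ⟨⟨r (prefixSet σ (σ x + 1)) - 1, by omega⟩, ?_, by simp; omega⟩
        rw [Fin.le_def]
        simp only
        omega
    have hjk : (j : ℕ) + 1 < k := by
      have := hle e
      rw [hU] at he
      omega
    obtain ⟨hd, hd'⟩ := hb ⟨j + 1, hjk⟩
    set d := b ⟨j + 1, hjk⟩
    simp only at hd hd'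
    have hUP : (Finset.univ.filter (· ≤ j)).biUnion X = prefixSet σ (σ d) := by
      ext x
      rw [hU, mem_prefixSet]
      constructor
      · intro h
        by_contra! hlt
        have := hmono (Nat.add_le_add_right hlt 1)
        omega
      · intro h
        exact (hmono h).trans hd.le
    rw [hUP] at he ⊢
    exact rank_lt_rank_insert_of_optimal hr hopt (by omega) he
  · rw [hX] at he he'
    by_contra! hlt
    have h1 := hmono (Nat.add_le_add_right (Fin.le_def.1 hlt) 1)
    have h2 := Fin.lt_def.1 hil
    omega
end

section
/- Let G be a simple graph on n vertices and let G̅ be its complement. For every bijection π : V(G) → {1,…,n}, letting π′ = n + 1 − π, it holds that ∑_{(x,y) ∈ E(G)} max{π(x), π(y)} = (n³ − n)/3 − (n+1)·|E(G̅)| + ∑_{(x,y) ∈ E(G̅)} min{π′(x), π′(y)}. -/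
/-- The MLVC weight of an edge: `max{π(x), π(y)}`, with the bijection `π : V ≃ Fin n`
interpreted as a labeling by `{1,…,n}` via `v ↦ (π v) + 1`. -/
def maxLabel {V : Type*} {n : ℕ} (π : V ≃ Fin n) : Sym2 V → ℕ :=
  Sym2.lift ⟨fun x y => max ((π x : ℕ) + 1) ((π y : ℕ) + 1), fun _ _ => max_comm _ _⟩

/-- The MSVC weight of an edge: `min{π(x), π(y)}`. -/
def minLabel {V : Type*} {n : ℕ} (π : V ≃ Fin n) : Sym2 V → ℕ :=
  Sym2.lift ⟨fun x y => min ((π x : ℕ) + 1) ((π y : ℕ) + 1), fun _ _ => min_comm _ _⟩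

/-- The sum of `max{i, j}` over all pairs `0 ≤ i < j < n`, with labels shifted by one. -/
theorem three_mul_sum_lt_succ (n : ℕ) :
    3 * ∑ p : Fin n × Fin n with p.1 < p.2, ((p.2 : ℤ) + 1) = (n : ℤ) ^ 3 - n := by
  have h : ∑ p : Fin n × Fin n with p.1 < p.2, ((p.2 : ℤ) + 1) =
      ∑ j ∈ Finset.range n, (j : ℤ) * (j + 1) := by
    rw [Finset.sum_filter, Fintype.sum_prod_type_right, ← Fin.sum_univ_eq_sum_range
      (fun j => (j : ℤ) * (j + 1))]
    refine Finset.sum_congr rfl fun j _ => ?_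
    rw [← Finset.sum_filter]
    simp [Finset.filter_gt_eq_Iio]
  rw [h]
  clear h
  induction n with
  | zero => simp
  | succ k ih =>
    rw [Finset.sum_range_succ, mul_add, ih]
    push_cast
    ring

theorem sum_not_isDiag_maxLabel {V : Type*} [Fintype V] [DecidableEq V] {n : ℕ} (π : V ≃ Fin n) :
    ∑ e : Sym2 V with ¬ e.IsDiag, (maxLabel π e : ℤ) =
      ∑ p : Fin n × Fin n with p.1 < p.2, ((p.2 : ℤ) + 1) := by
  symm
  refine Finset.sum_bij (fun p _ => s(π.symm p.1, π.symm p.2)) ?_ ?_ ?_ ?_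
  · rintro ⟨i, j⟩ h
    simpa using (Finset.mem_filter.1 h).2.ne
  · rintro ⟨i, j⟩ h ⟨k, l⟩ h' he
    simp only [Finset.mem_filter, Finset.mem_univ, true_and] at h h'
    simp only [Sym2.eq_iff, EmbeddingLike.apply_eq_iff_eq] at he
    rcases he with ⟨rfl, rfl⟩ | ⟨rfl, rfl⟩
    · rfl
    · exact absurd h h'.asymm
  · intro e he
    induction e with | _ x y
    have hxy : π x ≠ π y := by simpa using he
    rcases hxy.lt_or_gt with h | h
    · exact ⟨(π x, π y), by simpa using h, by simp⟩
    · exact ⟨(π y, π x), by simpa using h, by simp [Sym2.eq_swap]⟩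
  · rintro ⟨i, j⟩ h
    simp only [Finset.mem_filter, Finset.mem_univ, true_and] at h
    have h' : (i : ℕ) < j := h
    simp only [maxLabel, Sym2.lift_mk, Equiv.apply_symm_apply]
    omega

theorem sum_edgeFinset_add_sum_edgeFinset_compl {V M : Type*} [Fintype V] [DecidableEq V]
    [AddCommMonoid M] (G : SimpleGraph V) [DecidableRel G.Adj] (f : Sym2 V → M) :
    ∑ e ∈ G.edgeFinset, f e + ∑ e ∈ Gᶜ.edgeFinset, f e = ∑ e : Sym2 V with ¬ e.IsDiag, f e := by
  rw [← Finset.sum_union]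
  · refine Finset.sum_congr ?_ fun _ _ => rfl
    ext e
    induction e with | _ x y
    have : G.Adj x y → x ≠ y := SimpleGraph.Adj.ne
    simp
    tauto
  · rw [Finset.disjoint_left]
    intro e
    induction e with | _ x y
    simp
    tauto

theorem maxLabel_add_minLabel {V : Type*} {n : ℕ} (π πs : V ≃ Fin n)
    (hπs : ∀ v : V, (πs v : ℕ) + 1 = n + 1 - ((π v : ℕ) + 1)) (e : Sym2 V) :
    maxLabel π e + minLabel πs e = n + 1 := by
  induction e with | _ x y
  simp only [maxLabel, minLabel, Sym2.lift_mk, hπs]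
  omega

theorem stmt_3 {V : Type*} [Fintype V] [DecidableEq V] {n : ℕ}
    (hn : Fintype.card V = n) (G : SimpleGraph V) [DecidableRel G.Adj]
    (π πs : V ≃ Fin n)
    (hπs : ∀ v : V, (πs v : ℕ) + 1 = n + 1 - ((π v : ℕ) + 1)) :
    (∑ e ∈ G.edgeFinset, (maxLabel π e : ℤ)) =
      ((n : ℤ) ^ 3 - n) / 3 - (n + 1) * (Gᶜ.edgeFinset.card : ℤ) +
        ∑ e ∈ Gᶜ.edgeFinset, (minLabel πs e : ℤ) := by
  have hsum := sum_edgeFinset_add_sum_edgeFinset_compl G fun e => (maxLabel π e : ℤ)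
  have htotal := three_mul_sum_lt_succ n
  rw [sum_not_isDiag_maxLabel] at hsum
  have hcompl : ∑ e ∈ Gᶜ.edgeFinset, (maxLabel π e : ℤ) + ∑ e ∈ Gᶜ.edgeFinset, (minLabel πs e : ℤ) =
      (n + 1) * (Gᶜ.edgeFinset.card : ℤ) := by
    rw [← Finset.sum_add_distrib, mul_comm, ← nsmul_eq_mul]
    exact Finset.sum_eq_card_nsmul fun e _ => mod_cast maxLabel_add_minLabel π πs hπs e
  rw [← htotal, Int.mul_ediv_cancel_left _ three_ne_zero]
  linarith
end

section
/- Let G be a connected bridgeless cactus graph. Then the quantity min over bijections π : E(T) → {1,…,|E(T)|} of ∑_{e ∈ E(G) \ E(T)} max C(T,e)_π is the same for every spanning tree T of G; that is, every spanning tree of G admits an ordering of its edges attaining the minimum over all spanning trees and all orderings. -/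
open SimpleGraph
open scoped Classical

/-- A graph is a cactus iff every edge lies on at most one cycle, i.e. any two cycles
sharing an edge have the same edge set (equivalently, every block is a cycle or an edge). -/
def IsCactus {V : Type*} [DecidableEq V] (G : SimpleGraph V) : Prop :=
  ∀ (u v : V) (c : G.Walk u u) (c' : G.Walk v v), c.IsCycle → c'.IsCycle →
    ∀ e : Sym2 V, e ∈ c.edges → e ∈ c'.edges → c.edges.toFinset = c'.edges.toFinset

/-- For a spanning tree `T` and an edge `e = s(u,v)`, the set `C(T,e) − e` of tree edges on the
fundamental circuit of `e`: those tree edges `f` whose deletion separates `u` from `v` in `T`. -/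
noncomputable def fundEdges {V : Type*} [Fintype V] [DecidableEq V] (T : SimpleGraph V) :
    Sym2 V → Finset (Sym2 V) :=
  Sym2.lift ⟨fun u v =>
    Finset.univ.filter fun f => f ∈ T.edgeSet ∧ ¬(T.deleteEdges {f}).Reachable u v,
    fun u v => by
      ext f
      simp only [Finset.mem_filter]
      rw [SimpleGraph.reachable_comm]⟩

/-- The MLOP-style objective for a spanning tree `T` of `G` and an ordering `π` of the
tree edges: `∑_{e ∈ E(G) \ E(T)} max C(T,e)_π`. -/
noncomputable def treeObj {V : Type*} [Fintype V] [DecidableEq V] (G T : SimpleGraph V)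
    (π : Sym2 V → ℕ) : ℕ :=
  ∑ e ∈ Finset.univ.filter (fun e : Sym2 V => e ∈ G.edgeSet ∧ e ∉ T.edgeSet),
    (fundEdges T e).sup π

/-- Two edges of `G` are related iff some cycle of `G` passes through both. -/
def OnCommonCycle {V : Type*} (G : SimpleGraph V) (e f : Sym2 V) : Prop :=
  ∃ (u : V) (c : G.Walk u u), c.IsCycle ∧ e ∈ c.edges ∧ f ∈ c.edges

namespace OnCommonCycle

variable {V : Type*} {G : SimpleGraph V} {e f g : Sym2 V}

theorem symm (h : OnCommonCycle G e f) : OnCommonCycle G f e := by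
  obtain ⟨u, c, hc, he, hf⟩ := h
  exact ⟨u, c, hc, hf, he⟩

theorem mem_edgeSet_right (h : OnCommonCycle G e f) : f ∈ G.edgeSet := by
  obtain ⟨u, c, -, -, hf⟩ := h
  exact c.edges_subset_edgeSet hf

theorem refl_of_not_isBridge (he : e ∈ G.edgeSet) (h : ¬G.IsBridge e) :
    OnCommonCycle G e e := by
  rw [isBridge_iff_forall_cycle_notMem he] at h
  push Not at h
  obtain ⟨u, c, hc, hec⟩ := h
  exact ⟨u, c, hc, hec, hec⟩

theorem mem_edges_of_isCycle [DecidableEq V] (hG : IsCactus G) (h : OnCommonCycle G e f) {u : V}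
    {c : G.Walk u u} (hc : c.IsCycle) (he : e ∈ c.edges) : f ∈ c.edges := by
  obtain ⟨v, c', hc', he', hf'⟩ := h
  have := hG v u c' c hc' hc e he' he
  rw [← List.mem_toFinset] at hf' ⊢
  rwa [← this]

theorem trans [DecidableEq V] (hG : IsCactus G) (h : OnCommonCycle G e f)
    (h' : OnCommonCycle G f g) : OnCommonCycle G e g := by
  obtain ⟨u, c, hc, he, hf⟩ := h
  exact ⟨u, c, hc, he, h'.mem_edges_of_isCycle hG hc hf⟩

/-- A cycle of `G` through `e` has an edge outside any acyclic graph. -/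
theorem exists_notMem_of_isAcyclic {T : SimpleGraph V} (hT : T.IsAcyclic)
    (h : OnCommonCycle G e e) : ∃ a, OnCommonCycle G e a ∧ a ∉ T.edgeSet := by
  obtain ⟨u, c, hc, he, -⟩ := h
  by_contra! hall
  exact hT _ (hc.transfer fun a ha => hall a ⟨u, c, hc, he, ha⟩)

end OnCommonCycle

section

variable {V : Type*} [Fintype V] [DecidableEq V] {G T T' : SimpleGraph V}

theorem mem_edgeSet_of_mem_fundEdges {e f : Sym2 V} (h : f ∈ fundEdges T e) :
    f ∈ T.edgeSet := by
  induction e with | h u v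
  simp only [fundEdges, Sym2.lift_mk, Finset.mem_filter] at h
  exact h.2.1

theorem mem_fundEdges_iff_mem_edges (hT : T.IsAcyclic) {u v : V} {p : T.Walk v u} (hp : p.IsPath)
    {f : Sym2 V} : f ∈ fundEdges T s(u, v) ↔ f ∈ p.edges := by
  simp only [fundEdges, Sym2.lift_mk, Finset.mem_filter, Finset.mem_univ, true_and]
  constructor
  · rintro ⟨-, h⟩
    by_contra hf
    exact h ⟨(p.toDeleteEdge f hf).reverse⟩
  · refine fun hf => ⟨p.edges_subset_edgeSet hf, fun hr => ?_⟩
    obtain ⟨q, hq⟩ := hr.symm.exists_isPath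
    have hle := T.deleteEdges_le {f}
    have hpq : p = q.mapLe hle :=
      congrArg Subtype.val
        ((hT.subsingleton_path v u).elim ⟨p, hp⟩ ⟨q.mapLe hle, hq.mapLe hle⟩)
    rw [hpq, Walk.edges_mapLe_eq_edges] at hf
    simpa using q.edges_subset_edgeSet hf

/-- In a cactus, a fundamental circuit consists of all edges on a common cycle with the
edge that closes it. -/
theorem mem_fundEdges_iff (hG : IsCactus G) (hTG : T ≤ G) (hT : T.IsTree) {e f : Sym2 V}
    (he : e ∈ G.edgeSet) (heT : e ∉ T.edgeSet) :
    f ∈ fundEdges T e ↔ OnCommonCycle G e f ∧ f ≠ e := by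
  induction e with | h u v
  rw [mem_edgeSet] at he
  obtain ⟨p, hp⟩ := hT.connected.exists_isPath v u
  rw [mem_fundEdges_iff_mem_edges hT.isAcyclic hp]
  have hcyc : (Walk.cons he (p.mapLe hTG)).IsCycle := by
    rw [Walk.cons_isCycle_iff, Walk.edges_mapLe_eq_edges]
    exact ⟨hp.mapLe hTG, fun h => heT (p.edges_subset_edgeSet h)⟩
  constructor
  · intro hf
    refine ⟨⟨u, _, hcyc, by simp, ?_⟩, ?_⟩
    · rw [Walk.edges_cons, Walk.edges_mapLe_eq_edges]
      exact List.mem_cons_of_mem _ hf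
    · rintro rfl
      exact heT (p.edges_subset_edgeSet hf)
  · rintro ⟨h, hne⟩
    have := h.mem_edges_of_isCycle hG hcyc (by simp)
    rw [Walk.edges_cons, Walk.edges_mapLe_eq_edges] at this
    exact (List.mem_cons.1 this).resolve_left hne

theorem OnCommonCycle.eq_of_notMem (hG : IsCactus G) (hTG : T ≤ G) (hT : T.IsTree) {e f : Sym2 V}
    (h : OnCommonCycle G e f) (he : e ∉ T.edgeSet) (hf : f ∉ T.edgeSet) : f = e := by
  by_contra hne
  exact hf (mem_edgeSet_of_mem_fundEdges
    ((mem_fundEdges_iff hG hTG hT h.symm.mem_edgeSet_right he).2 ⟨h, hne⟩))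

/-- The edges of a bridgeless cactus can be permuted within their cycles so that the edges
outside one spanning tree go to the edges outside another. -/
theorem exists_involutive_edge_exchange (hbridgeless : ∀ e ∈ G.edgeSet, ¬G.IsBridge e)
    (hG : IsCactus G) (hTG : T ≤ G) (hT'G : T' ≤ G) (hT : T.IsTree) (hT' : T'.IsTree) :
    ∃ σ : Sym2 V → Sym2 V, Function.Involutive σ ∧ (∀ e ∈ G.edgeSet, OnCommonCycle G e (σ e)) ∧
      (∀ e, σ e ∈ G.edgeSet ↔ e ∈ G.edgeSet) ∧ ∀ e, σ e ∈ T.edgeSet ↔ e ∈ T'.edgeSet := by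
  have refl (e) (he : e ∈ G.edgeSet) := OnCommonCycle.refl_of_not_isBridge he (hbridgeless e he)
  have exists_out {S : SimpleGraph V} (hS : S.IsTree) (e : Sym2 V) :
      ∃ a, e ∈ G.edgeSet → OnCommonCycle G e a ∧ a ∉ S.edgeSet := by
    by_cases he : e ∈ G.edgeSet
    · exact ((refl e he).exists_notMem_of_isAcyclic hS.isAcyclic).imp fun a ha _ => ha
    · exact ⟨e, fun h => absurd h he⟩
  choose a ha using exists_out hT
  choose b hb using exists_out hT'
  have a_eq {e f} (h : OnCommonCycle G e f) (hf : f ∉ T.edgeSet) : a e = f :=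
    have hae := ha e h.symm.mem_edgeSet_right
    (h.symm.trans hG hae.1).eq_of_notMem hG hTG hT hf hae.2
  have b_eq {e f} (h : OnCommonCycle G e f) (hf : f ∉ T'.edgeSet) : b e = f :=
    have hbe := hb e h.symm.mem_edgeSet_right
    (h.symm.trans hG hbe.1).eq_of_notMem hG hT'G hT' hf hbe.2
  let σ (e : Sym2 V) : Sym2 V := if e ∈ G.edgeSet then Equiv.swap (a e) (b e) e else e
  have σ_of_mem {e} (he : e ∈ G.edgeSet) : σ e = Equiv.swap (a e) (b e) e := if_pos he
  have σ_of_notMem {e} (he : e ∉ G.edgeSet) : σ e = e := if_neg he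
  have hσ (e) (he : e ∈ G.edgeSet) : OnCommonCycle G e (σ e) := by
    rw [σ_of_mem he, Equiv.swap_apply_def]
    split_ifs
    exacts [(hb e he).1, (ha e he).1, refl e he]
  have hσG (e) : σ e ∈ G.edgeSet ↔ e ∈ G.edgeSet := by
    by_cases he : e ∈ G.edgeSet
    · exact iff_of_true (hσ e he).mem_edgeSet_right he
    · rw [σ_of_notMem he]
  have aσ {e} (he : e ∈ G.edgeSet) : a (σ e) = a e :=
    a_eq ((hσ e he).symm.trans hG (ha e he).1) (ha e he).2
  have bσ {e} (he : e ∈ G.edgeSet) : b (σ e) = b e :=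
    b_eq ((hσ e he).symm.trans hG (hb e he).1) (hb e he).2
  refine ⟨σ, fun e => ?_, hσ, hσG, fun e => ?_⟩
  · by_cases he : e ∈ G.edgeSet
    · rw [σ_of_mem ((hσG e).2 he), aσ he, bσ he, σ_of_mem he, Equiv.swap_apply_self]
    · rw [σ_of_notMem he, σ_of_notMem he]
  · by_cases he : e ∈ G.edgeSet
    · have memT : σ e ∉ T.edgeSet ↔ σ e = a e :=
        ⟨fun h => (a_eq (hσ e he) h).symm, fun h => h ▸ (ha e he).2⟩
      have memT' : e ∉ T'.edgeSet ↔ e = b e :=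
        ⟨fun h => (b_eq (refl e he) h).symm, fun h => h ▸ (hb e he).2⟩
      rw [← not_iff_not, memT, memT', σ_of_mem he, Equiv.swap_apply_eq_iff, Equiv.swap_apply_left]
    · rw [σ_of_notMem he]
      exact iff_of_false (fun h => he (edgeSet_mono hTG h)) fun h => he (edgeSet_mono hT'G h)

/-- Every ordering of a spanning tree of a bridgeless cactus can be transported to any other
spanning tree without changing the objective. -/
theorem exists_bijOn_treeObj_eq (hbridgeless : ∀ e ∈ G.edgeSet, ¬G.IsBridge e)
    (hG : IsCactus G) (hTG : T ≤ G) (hT'G : T' ≤ G) (hT : T.IsTree) (hT' : T'.IsTree)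
    {π : Sym2 V → ℕ} (hπ : Set.BijOn π T.edgeSet (Set.Icc 1 T.edgeSet.ncard)) :
    ∃ π' : Sym2 V → ℕ, Set.BijOn π' T'.edgeSet (Set.Icc 1 T'.edgeSet.ncard) ∧
      treeObj G T π = treeObj G T' π' := by
  obtain ⟨σ, hinv, hσ, hσG, hσT⟩ :=
    exists_involutive_edge_exchange hbridgeless hG hTG hT'G hT hT'
  have hbij : Set.BijOn σ T'.edgeSet T.edgeSet :=
    ⟨fun e he => (hσT e).2 he, hinv.injective.injOn,
      fun e he => ⟨σ e, by rwa [← hσT, hinv e], hinv e⟩⟩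
  have hcard : T'.edgeSet.ncard = T.edgeSet.ncard := by
    rw [← hbij.image_eq, Set.ncard_image_of_injective _ hinv.injective]
  refine ⟨π ∘ σ, hcard ▸ hπ.comp hbij, ?_⟩
  have hfund {e} (he : e ∈ G.edgeSet) (heT' : e ∉ T'.edgeSet) :
      fundEdges T (σ e) = (fundEdges T' e).image σ := by
    ext f
    rw [mem_fundEdges_iff hG hTG hT ((hσG e).2 he) (mt (hσT e).1 heT'), Finset.mem_image]
    constructor
    · rintro ⟨h, hne⟩
      refine ⟨σ f, (mem_fundEdges_iff hG hT'G hT' he heT').2 ⟨?_, ?_⟩, hinv f⟩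
      · exact ((hσ e he).trans hG h).trans hG (hσ f h.mem_edgeSet_right)
      · rintro rfl
        exact hne (hinv f).symm
    · rintro ⟨g, hg, rfl⟩
      obtain ⟨h, hne⟩ := (mem_fundEdges_iff hG hT'G hT' he heT').1 hg
      exact ⟨((hσ e he).symm.trans hG h).trans hG (hσ g h.mem_edgeSet_right),
        hinv.injective.ne hne⟩
  unfold treeObj
  refine (Finset.sum_bij' (fun e _ => σ e) (fun e _ => σ e) ?_ ?_ (fun e _ => hinv e)
    (fun e _ => hinv e) ?_).symm
  · simp [hσG, hσT]
  · intro e he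
    simpa [hσG, ← hσT (σ e), hinv e] using he
  · intro e he
    simp only [Finset.mem_filter, Finset.mem_univ, true_and] at he
    rw [hfund he.1 he.2, Finset.sup_image]

end

theorem stmt_5 {V : Type*} [Fintype V] [DecidableEq V] (G : SimpleGraph V)
    (hconn : G.Connected)
    (hbridgeless : ∀ e ∈ G.edgeSet, ¬G.IsBridge e)
    (hcactus : IsCactus G)
    (T T' : SimpleGraph V) (hTG : T ≤ G) (hT'G : T' ≤ G)
    (hT : T.IsTree) (hT' : T'.IsTree) :
    sInf {v : ℕ | ∃ π : Sym2 V → ℕ,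
        Set.BijOn π T.edgeSet (Set.Icc 1 T.edgeSet.ncard) ∧ v = treeObj G T π} =
      sInf {v : ℕ | ∃ π : Sym2 V → ℕ,
        Set.BijOn π T'.edgeSet (Set.Icc 1 T'.edgeSet.ncard) ∧ v = treeObj G T' π} := by
  congr 1
  ext v
  constructor
  · rintro ⟨π, hπ, rfl⟩
    exact exists_bijOn_treeObj_eq hbridgeless hcactus hTG hT'G hT hT' hπ
  · rintro ⟨π, hπ, rfl⟩
    exact exists_bijOn_treeObj_eq hbridgeless hcactus hT'G hTG hT' hT hπ
end

section
/- Let G be a d-regular simple graph on n vertices with d ≥ 1. Then there exists a bijection π : V(G) → {1,…,n} such that ∑_{(u,v) ∈ E(G)} max{π(u), π(v)} ≤ d·n·(n+1)/3. -/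
theorem sum_fin_offDiag_max (n : ℕ) :
    (∑ i : Fin n, ∑ j : Fin n,
      if i = j then (0 : ℝ) else ((max ((i : ℕ) + 1) ((j : ℕ) + 1) : ℕ) : ℝ)) =
      2 * (n + 1) * n * (n - 1) / 3 := by
  induction n with
  | zero => simp
  | succ n ih =>
    have hl (i : Fin n) : max ((i : ℕ) + 1) (n + 1) = n + 1 := by omega
    have hr (i : Fin n) : max (n + 1) ((i : ℕ) + 1) = n + 1 := by omega
    simp only [Fin.sum_univ_castSucc, Fin.castSucc_inj, Fin.val_castSucc, Fin.val_last,
      Finset.sum_add_distrib, ih, hl, hr, Fin.castSucc_ne_last, (Fin.castSucc_ne_last _).symm,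
      if_true, if_false, Finset.sum_const, Finset.card_univ, Fintype.card_fin, nsmul_eq_mul]
    push_cast
    ring

theorem exists_perm_map_pair {V : Type*} [DecidableEq V] {x y a b : V} (hxy : x ≠ y)
    (hab : a ≠ b) : ∃ σ : Equiv.Perm V, σ x = a ∧ σ y = b := by
  refine ⟨(Equiv.swap x a).trans (Equiv.swap (Equiv.swap x a y) b), ?_, ?_⟩
  · have h : a ≠ Equiv.swap x a y := by
      intro h
      apply hxy
      apply (Equiv.swap x a).injective
      rw [Equiv.swap_apply_left, ← h]
    simp [Equiv.swap_apply_of_ne_of_ne h hab]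
  · simp

theorem sum_equiv_max_eq {V : Type*} [Fintype V] [DecidableEq V] {n : ℕ}
    (hn : Fintype.card V = n) {x y : V} (hxy : x ≠ y) :
    ∑ π : V ≃ Fin n, (maxLabel π s(x, y) : ℝ) =
      Fintype.card (V ≃ Fin n) * (2 * (n + 1) / 3) := by
  have hinv (a b : V) (hab : a ≠ b) :
      ∑ π : V ≃ Fin n, (maxLabel π s(a, b) : ℝ) = ∑ π : V ≃ Fin n, (maxLabel π s(x, y) : ℝ) := by
    obtain ⟨σ, rfl, rfl⟩ := exists_perm_map_pair hxy hab
    exact Fintype.sum_equiv (Equiv.equivCongr σ.symm (Equiv.refl _)) _ _ fun π => by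
      simp [maxLabel]
  have htotal (π : V ≃ Fin n) :
      (∑ a, ∑ b, if a = b then (0 : ℝ) else (maxLabel π s(a, b) : ℝ)) =
        2 * (n + 1) * n * (n - 1) / 3 := by
    rw [← sum_fin_offDiag_max]
    refine Fintype.sum_equiv π _ _ fun a => Fintype.sum_equiv π _ _ fun b => ?_
    simp [maxLabel]
  have hcount (c : ℝ) : (∑ a : V, ∑ b : V, if a = b then 0 else c) = n * (n - 1) * c := by
    have h (a b : V) : (if a = b then 0 else c) = c - if a = b then c else 0 := by
      split_ifs <;> simp
    simp only [h, Finset.sum_sub_distrib, Finset.sum_const, Finset.sum_ite_eq, Finset.mem_univ,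
      if_true, Finset.card_univ, hn, nsmul_eq_mul]
    ring
  have hswap : (n : ℝ) * (n - 1) * ∑ π : V ≃ Fin n, (maxLabel π s(x, y) : ℝ) =
      Fintype.card (V ≃ Fin n) * (2 * (n + 1) * n * (n - 1) / 3) := by
    have h := Finset.sum_congr (rfl : (Finset.univ : Finset (V ≃ Fin n)) = _) fun π _ => htotal π
    rw [Finset.sum_const, Finset.card_univ, nsmul_eq_mul, Finset.sum_comm] at h
    rw [← hcount, ← h]
    refine Finset.sum_congr rfl fun a _ => ?_
    rw [Finset.sum_comm]
    refine Finset.sum_congr rfl fun b _ => ?_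
    split_ifs with h
    · simp
    · exact (hinv a b h).symm
  have hn2 : (2 : ℝ) ≤ n := by
    have : 1 < Fintype.card V := Fintype.one_lt_card_iff.mpr ⟨x, y, hxy⟩
    exact_mod_cast hn ▸ this
  have hpos : (n : ℝ) * (n - 1) ≠ 0 := by
    apply ne_of_gt
    apply mul_pos <;> linarith
  apply mul_left_cancel₀ hpos
  rw [hswap]
  ring

theorem stmt_12 {V : Type*} [Fintype V] [DecidableEq V] {n d : ℕ}
    (hn : Fintype.card V = n) (G : SimpleGraph V) [DecidableRel G.Adj]
    (hreg : G.IsRegularOfDegree d) (hd : 1 ≤ d) :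
    ∃ π : V ≃ Fin n,
      (∑ e ∈ G.edgeFinset, (maxLabel π e : ℝ)) ≤ (d : ℝ) * n * (n + 1) / 3 := by
  have hE : (n : ℝ) * d = 2 * (G.edgeFinset.card : ℝ) := by
    have h := G.sum_degrees_eq_twice_card_edges
    simp only [hreg.degree_eq, Finset.sum_const, Finset.card_univ, hn, smul_eq_mul] at h
    exact_mod_cast h
  have hne : (Finset.univ : Finset (V ≃ Fin n)).Nonempty :=
    ⟨Fintype.equivFinOfCardEq hn, Finset.mem_univ _⟩
  have hsum : ∑ π : V ≃ Fin n, ∑ e ∈ G.edgeFinset, (maxLabel π e : ℝ) =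
      ∑ _π : V ≃ Fin n, (d : ℝ) * n * (n + 1) / 3 := by
    have hedge : ∀ e ∈ G.edgeFinset, ∑ π : V ≃ Fin n, (maxLabel π e : ℝ) =
        Fintype.card (V ≃ Fin n) * (2 * (n + 1) / 3) := by
      intro e
      induction e with
      | _ x y =>
        intro he
        exact sum_equiv_max_eq hn (G.ne_of_adj (by simpa using he))
    rw [Finset.sum_comm, Finset.sum_congr rfl hedge]
    simp only [Finset.sum_const, Finset.card_univ, nsmul_eq_mul]
    linear_combination (-(Fintype.card (V ≃ Fin n) : ℝ) * (n + 1) / 3) * hE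
  obtain ⟨π, -, hπ⟩ := Finset.exists_le_of_sum_le hne hsum.le
  exact ⟨π, hπ⟩
end

section
/- Let G be a d-regular simple graph on n vertices. Suppose u : E(G) × {1,…,n} → ℝ≥0 and x : V(G) × {1,…,n} → ℝ≥0 satisfy: (i) ∑_{v ∈ V(G)} x(v,t) ≤ 1 for every t ∈ {1,…,n}; and (ii) u(e,t) + ∑_{t′ < t} x(v,t′) ≥ 1 for every e ∈ E(G), every v ∈ e, and every t ∈ {1,…,n}. Then ∑_{e ∈ E(G)} ∑_{t=1}^n u(e,t) ≥ d·n·(n+1)/4. -/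
/-- Summing a function of edges over all incidences counts every edge twice. -/
theorem SimpleGraph.sum_sum_incidenceFinset {V R : Type*} [Fintype V] [DecidableEq V]
    [NonAssocSemiring R] (G : SimpleGraph V) [DecidableRel G.Adj] (f : Sym2 V → R) :
    ∑ v : V, ∑ e ∈ G.incidenceFinset v, f e = 2 * ∑ e ∈ G.edgeFinset, f e := by
  rw [Finset.sum_comm' (t' := G.edgeFinset) (s' := fun e => e.toFinset), Finset.mul_sum]
  · refine Finset.sum_congr rfl fun e he => ?_
    have h : ¬ e.IsDiag := G.not_isDiag_of_mem_edgeFinset he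
    rw [Finset.sum_const, Sym2.card_toFinset_of_not_isDiag e h, nsmul_eq_mul, Nat.cast_two]
  · intro v e
    simp [SimpleGraph.incidenceFinset_eq_filter, and_comm]

/-- In a `d`-regular graph, if each edge value is at least `1 - w v` at both of its endpoints `v`,
then the edge values sum to at least `d / 2` times the sum of all `1 - w v`. -/
theorem SimpleGraph.IsRegularOfDegree.mul_card_sub_sum_le {V : Type*} [Fintype V] [DecidableEq V]
    {d : ℕ} {G : SimpleGraph V} [DecidableRel G.Adj] (hreg : G.IsRegularOfDegree d)
    (f : Sym2 V → ℝ) (w : V → ℝ) (h : ∀ e ∈ G.edgeFinset, ∀ v ∈ e, 1 ≤ f e + w v) :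
    (d : ℝ) * (Fintype.card V - ∑ v, w v) ≤ 2 * ∑ e ∈ G.edgeFinset, f e := by
  rw [← G.sum_sum_incidenceFinset f]
  calc (d : ℝ) * (Fintype.card V - ∑ v, w v) = ∑ v : V, d * (1 - w v) := by
        simp [← Finset.mul_sum, Finset.sum_sub_distrib]
    _ ≤ ∑ v : V, ∑ e ∈ G.incidenceFinset v, f e := by
        refine Finset.sum_le_sum fun v _ => ?_
        rw [← hreg v, ← G.card_incidenceFinset_eq_degree, ← nsmul_eq_mul]
        refine Finset.card_nsmul_le_sum _ _ _ fun e he => ?_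
        rw [SimpleGraph.incidenceFinset_eq_filter, Finset.mem_filter] at he
        linarith [h e he.1 v he.2]

theorem sum_Icc_sub_pred (m : ℕ) (c : ℝ) :
    ∑ t ∈ Finset.Icc 1 m, (c - ((t : ℝ) - 1)) = m * (c + 1) - m * (m + 1) / 2 := by
  induction m with
  | zero => simp
  | succ k ih =>
    rw [Finset.sum_Icc_succ_top (by omega), ih]
    push_cast
    ring


theorem stmt_13 {V : Type*} [Fintype V] [DecidableEq V] {n d : ℕ}
    (hn : Fintype.card V = n) (G : SimpleGraph V) [DecidableRel G.Adj]
    (hreg : G.IsRegularOfDegree d)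
    (u : Sym2 V → ℕ → ℝ) (x : V → ℕ → ℝ)
    (hu : ∀ (e : Sym2 V) (t : ℕ), 0 ≤ u e t)
    (hx : ∀ (v : V) (t : ℕ), 0 ≤ x v t)
    -- (i): at each time step at most one vertex is scheduled
    (hpack : ∀ t ∈ Finset.Icc 1 n, ∑ v : V, x v t ≤ 1)
    -- (ii): an edge is uncovered at time t unless all its endpoints appear strictly before t
    (hcov : ∀ e ∈ G.edgeFinset, ∀ v ∈ e, ∀ t ∈ Finset.Icc 1 n,
      1 ≤ u e t + ∑ t' ∈ Finset.Ico 1 t, x v t') :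
    (d : ℝ) * n * (n + 1) / 4 ≤ ∑ e ∈ G.edgeFinset, ∑ t ∈ Finset.Icc 1 n, u e t := by
  have step (t : ℕ) (ht : t ∈ Finset.Icc 1 n) :
      (d : ℝ) / 2 * (n - ((t : ℝ) - 1)) ≤ ∑ e ∈ G.edgeFinset, u e t := by
    obtain ⟨ht1, htn⟩ := Finset.mem_Icc.mp ht
    have hcount := hreg.mul_card_sub_sum_le (fun e => u e t)
      (fun v => ∑ t' ∈ Finset.Ico 1 t, x v t') fun e he v hv => hcov e he v hv t ht
    have hload : ∑ v : V, ∑ t' ∈ Finset.Ico 1 t, x v t' ≤ (t : ℝ) - 1 := by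
      rw [Finset.sum_comm]
      calc ∑ t' ∈ Finset.Ico 1 t, ∑ v : V, x v t' ≤ ∑ _t' ∈ Finset.Ico 1 t, (1 : ℝ) := by
            refine Finset.sum_le_sum fun t' ht' => hpack t' ?_
            rw [Finset.mem_Ico] at ht'
            exact Finset.mem_Icc.mpr ⟨ht'.1, by omega⟩
        _ = (t : ℝ) - 1 := by simp [Nat.cast_sub ht1]
    rw [hn] at hcount
    have hmul := mul_le_mul_of_nonneg_left hload (Nat.cast_nonneg (α := ℝ) d)
    linarith
  rw [Finset.sum_comm]
  calc (d : ℝ) * n * (n + 1) / 4 = ∑ t ∈ Finset.Icc 1 n, (d : ℝ) / 2 * (n - ((t : ℝ) - 1)) := by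
        rw [← Finset.mul_sum, sum_Icc_sub_pred]
        ring
    _ ≤ ∑ t ∈ Finset.Icc 1 n, ∑ e ∈ G.edgeFinset, u e t := Finset.sum_le_sum step
end

section
/- Let T and T′ be two trees on the same finite vertex set A. Then there exists a bijection φ : E(T) → E(T′) such that for every edge e ∈ E(T), the two endpoints of e lie in different connected components of the graph T′ with the edge φ(e) deleted. -/
namespace SimpleGraph

variable {V : Type*}

/-- Deleting any edge of the path joining `u` and `v` in an acyclic graph separates `u` from `v`. -/
theorem IsAcyclic.not_reachable_deleteEdges_of_mem_edges {G : SimpleGraph V} (hG : G.IsAcyclic)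
    {u v : V} {p : G.Walk u v} (hp : p.IsPath) {e : Sym2 V} (he : e ∈ p.edges) :
    ¬(G.deleteEdges {e}).Reachable u v := by
  intro h
  obtain ⟨q, hq⟩ := h.exists_isPath
  have hle : G.deleteEdges {e} ≤ G := deleteEdges_le _
  have hpq : q.mapLe hle = p :=
    congrArg Subtype.val ((hG.subsingleton_path u v).elim
      ⟨q.mapLe hle, (Walk.isPath_mapLe hle).mpr hq⟩ ⟨p, hp⟩)
  rw [← hpq, Walk.edges_mapLe_eq_edges] at he
  have := q.edges_subset_edgeSet he
  simp at this

/-- A graph in which the endpoints of every edge of a connected graph are joined is connected. -/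
theorem Connected.of_adj_reachable {G H : SimpleGraph V} (hG : G.Connected)
    (h : ∀ u v, G.Adj u v → H.Reachable u v) : H.Connected := by
  have := hG.nonempty
  refine Connected.mk fun u v => ?_
  obtain ⟨p⟩ := hG.preconnected u v
  induction p with
  | nil => exact Reachable.refl _
  | cons hadj _ ih => exact (h _ _ hadj).trans ih

/-- Hall's condition for the exchange relation between the edges of two trees. -/
theorem IsTree.card_le_card_of_separating [Fintype V] [DecidableEq V] {T T' : SimpleGraph V}
    (hT : T.IsTree) (hT' : T'.IsTree) {A N : Finset (Sym2 V)} (hA : (A : Set (Sym2 V)) ⊆ T.edgeSet)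
    (hN : ∀ u v, s(u, v) ∈ A → ∀ e ∈ T'.edgeSet, ¬(T'.deleteEdges {e}).Reachable u v → e ∈ N) :
    A.card ≤ N.card := by
  classical
  let S : Finset (Sym2 V) := N ∪ (T.edgeFinset \ A)
  have hconn : (fromEdgeSet (S : Set (Sym2 V))).Connected := by
    refine hT.connected.of_adj_reachable fun u v huv => ?_
    by_cases hmem : s(u, v) ∈ A
    · obtain ⟨p, hp⟩ := (hT'.connected.preconnected u v).exists_isPath
      refine ⟨p.transfer _ fun e he => ?_⟩
      have heT := p.edges_subset_edgeSet he
      rw [edgeSet_fromEdgeSet]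
      refine ⟨?_, T'.not_isDiag_of_mem_edgeSet heT⟩
      exact Finset.mem_coe.mpr <| Finset.mem_union_left _ <| hN u v hmem e heT <|
        hT'.isAcyclic.not_reachable_deleteEdges_of_mem_edges hp he
    · refine Adj.reachable ?_
      rw [fromEdgeSet_adj]
      exact ⟨by simp [S, hmem, huv], huv.ne⟩
  have hcard := hconn.card_vert_le_card_edgeSet_add_one
  have hsub : Nat.card (fromEdgeSet (S : Set (Sym2 V))).edgeSet ≤ S.card := by
    rw [← Set.ncard_coe_finset, ← Nat.card_coe_set_eq]
    refine Nat.card_mono S.finite_toSet ?_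
    rw [edgeSet_fromEdgeSet]
    exact Set.sdiff_subset
  have hAT : A ⊆ T.edgeFinset := fun e he => mem_edgeFinset.mpr (hA he)
  have hS : S.card ≤ N.card + (T.edgeFinset \ A).card := Finset.card_union_le _ _
  have hdiff := Finset.card_sdiff_add_card_eq_card hAT
  have hTcard := hT.card_edgeFinset
  rw [Nat.card_eq_fintype_card] at hcard
  omega

end SimpleGraph

theorem stmt_15 {V : Type*} [Fintype V] [DecidableEq V]
    (T T' : SimpleGraph V) (hT : T.IsTree) (hT' : T'.IsTree) :
    ∃ φ : Sym2 V → Sym2 V,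
      Set.BijOn φ T.edgeSet T'.edgeSet ∧
      ∀ u v : V, T.Adj u v → ¬(T'.deleteEdges {φ s(u, v)}).Reachable u v := by
  classical
  let t : T.edgeSet → Finset (Sym2 V) := fun e => T'.edgeFinset.filter fun e' =>
    ∀ u v, e.1 = s(u, v) → ¬(T'.deleteEdges {e'}).Reachable u v
  obtain ⟨f, hf, hft⟩ := (Finset.all_card_le_biUnion_card_iff_exists_injective t).mp fun s => by
    rw [← Finset.card_map (Function.Embedding.subtype _)]
    refine hT.card_le_card_of_separating hT' (fun e he => ?_) fun u v huv e' he' hsep => ?_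
    · obtain ⟨a, -, rfl⟩ := Finset.mem_map.mp (Finset.mem_coe.mp he)
      exact a.2
    · obtain ⟨a, ha, hae⟩ := Finset.mem_map.mp huv
      refine Finset.mem_biUnion.mpr ⟨a, ha, Finset.mem_filter.mpr ⟨by simpa using he', ?_⟩⟩
      intro x y hxy
      have hxy' : s(u, v) = s(x, y) := (show a.1 = s(u, v) from hae).symm.trans hxy
      rcases Sym2.eq_iff.mp hxy' with ⟨rfl, rfl⟩ | ⟨rfl, rfl⟩
      · exact hsep
      · exact fun h => hsep h.symm
  let φ : Sym2 V → Sym2 V := fun e => if h : e ∈ T.edgeSet then f ⟨e, h⟩ else e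
  have hφ (e : Sym2 V) (h : e ∈ T.edgeSet) : φ e = f ⟨e, h⟩ := dif_pos h
  have hmaps : Set.MapsTo φ T.edgeSet T'.edgeSet := fun e he => by
    rw [hφ e he]
    exact SimpleGraph.mem_edgeFinset.mp (Finset.mem_filter.mp (hft ⟨e, he⟩)).1
  have hinj : Set.InjOn φ T.edgeSet := fun a ha b hb hab => by
    rw [hφ a ha, hφ b hb] at hab
    exact congrArg Subtype.val (hf hab)
  refine ⟨φ, ⟨hmaps, hinj, ?_⟩, fun u v huv => ?_⟩
  · have hcard := hT.card_edgeFinset.trans hT'.card_edgeFinset.symm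
    have := Finset.surjOn_of_injOn_of_card_le (s := T.edgeFinset) (t := T'.edgeFinset) φ
      (by simpa using hmaps) (by simpa using hinj) (by omega)
    simpa using this
  · rw [hφ _ huv]
    exact (Finset.mem_filter.mp (hft ⟨s(u, v), huv⟩)).2 u v rfl
end

section
/- Let A be a finite set with |A| = n ≥ 2 and f : 2^A → ℝ≥0 a symmetric submodular function with f(∅) = 0, and let (T′, w) be a Gomory–Hu tree of f. Then for every tree T on vertex set A: ∑_{e ∈ E(T)} f(X_{e,T}) ≥ ∑_{e′ ∈ E(T′)} w(e′), where X_{e,T} denotes the vertex set of one of the two connected components of T − e (well-defined as a value of f since f is symmetric). Consequently, any Gomory–Hu tree minimizes ∑_{e ∈ E(T)} f(X_{e,T}) over all trees T on A. -/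
open scoped Classical

/-- The vertex set of the connected component of `T` with the edge `e` deleted
that contains `s`. -/
noncomputable def sideOf {α : Type*} [Fintype α] (T : SimpleGraph α) (e : Sym2 α) (s : α) :
    Finset α :=
  Finset.univ.filter fun a => (T.deleteEdges {e}).Reachable s a

/-- `(T, w)` is a Gomory–Hu tree of `f`. -/
def IsGomoryHuTree {α : Type*} [Fintype α] (f : Finset α → ℝ)
    (T : SimpleGraph α) (w : Sym2 α → ℝ) : Prop :=
  T.IsTree ∧
    ∀ s t : α, T.Adj s t →
      w s(s, t) = f (sideOf T s(s, t) s) ∧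
      ∀ X : Finset α, s ∈ X → t ∉ X → f (sideOf T s(s, t) s) ≤ f X

/-- The total weight `∑_{e ∈ E(T)} w(e)` of the edges of `T`. -/
noncomputable def treeEdgeSum {α : Type*} [Fintype α] (T : SimpleGraph α)
    (w : Sym2 α → ℝ) : ℝ :=
  ∑ e ∈ Finset.univ.filter (fun e : Sym2 α => e ∈ T.edgeSet), w e

namespace SimpleGraph

variable {V : Type*}

/-- In a connected graph, after deleting an edge every vertex is still reachable from one of
the two ends of that edge. -/
theorem Connected.reachable_deleteEdges_or {G : SimpleGraph V} (hG : G.Connected) (u v a : V) :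
    (G.deleteEdges {s(u, v)}).Reachable u a ∨ (G.deleteEdges {s(u, v)}).Reachable v a := by
  obtain ⟨p⟩ := hG.preconnected a u
  induction p with
  | nil => exact Or.inl (Reachable.refl _)
  | @cons a b c hab _ ih =>
    by_cases he : s(a, b) = s(c, v)
    · rcases Sym2.eq_iff.1 he with ⟨rfl, -⟩ | ⟨rfl, -⟩
      · exact Or.inl (Reachable.refl _)
      · exact Or.inr (Reachable.refl _)
    · have hba : (G.deleteEdges {s(c, v)}).Adj b a := by
        rw [deleteEdges_adj]
        exact ⟨hab.symm, by rwa [Sym2.eq_swap (a := b), Set.mem_singleton_iff]⟩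
      exact ih.imp (fun h => h.trans hba.reachable) (fun h => h.trans hba.reachable)

/-- Every edge of a path in an acyclic graph separates the ends of the path. -/
theorem IsAcyclic.not_reachable_deleteEdges {G : SimpleGraph V} (hG : G.IsAcyclic) {s t : V}
    (p : G.Path s t) {e : Sym2 V} (he : e ∈ (p : G.Walk s t).edges) :
    ¬ (G.deleteEdges {e}).Reachable s t := by
  intro h
  obtain ⟨q, hq⟩ := h.exists_isPath
  have hle : G.deleteEdges {e} ≤ G := deleteEdges_le _
  have hpq : p = ⟨q.mapLe hle, hq.mapLe hle⟩ := (hG.subsingleton_path s t).elim _ _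
  rw [hpq, Walk.edges_mapLe_eq_edges] at he
  have := q.edges_subset_edgeSet he
  simp [edgeSet_deleteEdges] at this

/-- Two trees on the same finite vertex set: the edges of the first can be assigned distinct
edges of the second so that each edge of the first is separated by the edge assigned to it. -/
theorem IsTree.exists_injective_separating [Fintype V] {T' T : SimpleGraph V}
    (hT' : T'.IsTree) (hT : T.IsTree) :
    ∃ φ : T'.edgeSet → Sym2 V, Function.Injective φ ∧ ∀ e', φ e' ∈ T.edgeSet ∧
      ∃ s t, (e' : Sym2 V) = s(s, t) ∧ ¬ (T.deleteEdges {φ e'}).Reachable s t := by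
  let N : T'.edgeSet → Finset (Sym2 V) := fun e' => Finset.univ.filter fun e =>
    e ∈ T.edgeSet ∧ ∃ s t, (e' : Sym2 V) = s(s, t) ∧ ¬ (T.deleteEdges {e}).Reachable s t
  suffices hall : ∀ S : Finset T'.edgeSet, S.card ≤ (S.biUnion N).card by
    obtain ⟨φ, hφ, hN⟩ := (Finset.all_card_le_biUnion_card_iff_exists_injective N).1 hall
    exact ⟨φ, hφ, fun e' => (Finset.mem_filter.1 (hN e')).2⟩
  intro S
  let R : Finset (Sym2 V) := Sᶜ.map (Function.Embedding.subtype _)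
  let H : SimpleGraph V := fromEdgeSet (↑(S.biUnion N ∪ R) : Set (Sym2 V))
  have hstep : ∀ s t, T'.Adj s t → H.Reachable s t := by
    intro s t hst
    by_cases hS : (⟨s(s, t), hst⟩ : T'.edgeSet) ∈ S
    · obtain ⟨p, hp⟩ := (hT.connected.preconnected s t).exists_isPath
      refine ⟨p.transfer H fun e he => ?_⟩
      have heT := p.edges_subset_edgeSet he
      rw [edgeSet_fromEdgeSet]
      refine ⟨?_, T.not_isDiag_of_mem_edgeSet heT⟩
      refine Finset.mem_coe.2 (Finset.mem_union_left _ (Finset.mem_biUnion.2 ⟨_, hS, ?_⟩))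
      exact Finset.mem_filter.2 ⟨Finset.mem_univ _, heT, s, t, rfl,
        hT.isAcyclic.not_reachable_deleteEdges ⟨p, hp⟩ he⟩
    · refine Adj.reachable ((fromEdgeSet_adj _).2 ⟨?_, hst.ne⟩)
      refine Finset.mem_coe.2 (Finset.mem_union_right _ (Finset.mem_map.2
        ⟨⟨s(s, t), hst⟩, ?_, rfl⟩))
      exact Finset.mem_compl.2 hS
  have hH : H.Connected := by
    have := hT'.connected.nonempty
    refine ⟨fun a b => ?_⟩
    obtain ⟨p⟩ := hT'.connected.preconnected a b
    induction p with
    | nil => exact Reachable.refl _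
    | cons h _ ih => exact (hstep _ _ h).trans ih
  have hcard := hH.card_vert_le_card_edgeSet_add_one
  have hHcard : Nat.card H.edgeSet ≤ (S.biUnion N).card + R.card := by
    refine le_trans ?_ (Finset.card_union_le _ _)
    rw [← Nat.card_eq_finsetCard]
    refine Nat.card_mono (Finset.finite_toSet _) ?_
    rw [edgeSet_fromEdgeSet]
    exact Set.sdiff_subset
  have hR : R.card + S.card = Fintype.card T'.edgeSet := by
    rw [Finset.card_map, add_comm, Finset.card_add_card_compl]
  have htree := hT'.card_edgeFinset
  rw [edgeFinset_card] at htree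
  rw [Nat.card_eq_fintype_card] at hcard
  omega

end SimpleGraph

/-- If `c` is a lower bound for the value of `f` on every set containing `s` but not `t`, then it
is a lower bound for its value on a side of any tree edge separating `s` from `t`. -/
theorem le_sideOf_of_not_reachable {α : Type*} [Fintype α] [DecidableEq α] {f : Finset α → ℝ}
    (hsym : ∀ S : Finset α, f S = f Sᶜ) {T : SimpleGraph α} (hT : T.IsTree) {u v s t : α} {c : ℝ}
    (hc : ∀ X : Finset α, s ∈ X → t ∉ X → c ≤ f X)
    (hst : ¬ (T.deleteEdges {s(u, v)}).Reachable s t) :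
    c ≤ f (sideOf T s(u, v) u) := by
  have hmem : ∀ a, a ∈ sideOf T s(u, v) u ↔ (T.deleteEdges {s(u, v)}).Reachable u a := by
    simp [sideOf]
  by_cases hs : (T.deleteEdges {s(u, v)}).Reachable u s
  · exact hc _ ((hmem s).2 hs) fun ht => hst (hs.symm.trans ((hmem t).1 ht))
  · rw [hsym]
    refine hc _ (by simpa [hmem] using hs) ?_
    have hvs := (hT.connected.reachable_deleteEdges_or u v s).resolve_left hs
    have ht := (hT.connected.reachable_deleteEdges_or u v t).resolve_right
      fun hvt => hst (hvs.symm.trans hvt)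
    simpa [hmem] using ht

theorem stmt_18 {α : Type*} [Fintype α] [DecidableEq α] {n : ℕ}
    (hn : Fintype.card α = n) (hn2 : 2 ≤ n) (f : Finset α → ℝ)
    (hnn : ∀ S : Finset α, 0 ≤ f S)
    (hsub : ∀ S T : Finset α, f (S ∪ T) + f (S ∩ T) ≤ f S + f T)
    (hsym : ∀ S : Finset α, f S = f Sᶜ)
    (hzero : f ∅ = 0)
    (T' : SimpleGraph α) (w : Sym2 α → ℝ) (hGH : IsGomoryHuTree f T' w) :
    ∀ T : SimpleGraph α, T.IsTree →
      -- `F e = f(X_{e,T})`, the value of `f` on either connected component of `T − e`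
      -- (well defined since `f` is symmetric)
      ∀ F : Sym2 α → ℝ,
        (∀ u v : α, T.Adj u v → F s(u, v) = f (sideOf T s(u, v) u)) →
        treeEdgeSum T' w ≤ treeEdgeSum T F := by
  intro T hT F hF
  obtain ⟨hT', hcut⟩ := hGH
  obtain ⟨φ, hφ, hsep⟩ := hT'.exists_injective_separating hT
  have hFnn : ∀ e ∈ T.edgeSet, 0 ≤ F e := by
    intro e he
    induction e with
    | _ u v => exact hF u v he ▸ hnn _
  have hle : ∀ e' : T'.edgeSet, w e' ≤ F (φ e') := by
    intro e'
    obtain ⟨he, s, t, hst, hreach⟩ := hsep e'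
    have hadj : T'.Adj s t := by
      rw [← SimpleGraph.mem_edgeSet, ← hst]
      exact e'.2
    generalize φ e' = e at he hreach
    induction e with
    | _ u v =>
      obtain ⟨hw, hmin⟩ := hcut s t hadj
      rw [hst, hw, hF u v he]
      exact le_sideOf_of_not_reachable hsym hT hmin hreach
  calc treeEdgeSum T' w = ∑ e' : T'.edgeSet, w e' :=
        Finset.sum_subtype _ (fun e => by simp) w
    _ ≤ ∑ e' : T'.edgeSet, F (φ e') := Finset.sum_le_sum fun e' _ => hle e'
    _ = ∑ e ∈ Finset.univ.map ⟨φ, hφ⟩, F e := by simp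
    _ ≤ treeEdgeSum T F := by
        refine Finset.sum_le_sum_of_subset_of_nonneg ?_ ?_
        · intro e he
          obtain ⟨e', -, rfl⟩ := Finset.mem_map.1 he
          exact Finset.mem_filter.2 ⟨Finset.mem_univ _, (hsep e').1⟩
        · intro e he _
          exact hFnn e (Finset.mem_filter.1 he).2
end

section
/- Let A be a finite set with |A| = n ≥ 2 and f : 2^A → ℝ≥0 a symmetric submodular function with f(∅) = 0. If (T, w) and (T′, w′) are both Gomory–Hu trees of f, then ∑_{e ∈ E(T)} w(e) = ∑_{e′ ∈ E(T′)} w′(e′); that is, every Gomory–Hu tree of f has the same total edge weight. -/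
open scoped Classical

/-- In an acyclic graph, deleting an edge of a path separates the ends of the path. -/
theorem SimpleGraph.IsAcyclic.not_reachable_deleteEdges_of_mem_edges_s19 {α : Type*}
    {G : SimpleGraph α} (hG : G.IsAcyclic) {u v : α} {p : G.Walk u v} (hp : p.IsPath)
    {e : Sym2 α} (he : e ∈ p.edges) : ¬ (G.deleteEdges {e}).Reachable u v := by
  intro h
  obtain ⟨q, hq⟩ := h.exists_isPath
  have hpq : p = q.mapLe (G.deleteEdges_le {e}) :=
    congrArg Subtype.val ((hG.subsingleton_path u v).elim ⟨p, hp⟩ ⟨_, hq.mapLe _⟩)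
  rw [hpq] at he
  have heq : e ∈ q.edges := by simpa using he
  simpa using q.edges_subset_edgeSet heq

/-- In a preconnected graph with the edge `s(u, v)` deleted, every vertex is reachable from
`u` or from `v`. -/
theorem SimpleGraph.Preconnected.reachable_deleteEdges_or {α : Type*} {G : SimpleGraph α}
    (hG : G.Preconnected) (u v a : α) :
    (G.deleteEdges {s(u, v)}).Reachable u a ∨ (G.deleteEdges {s(u, v)}).Reachable v a := by
  obtain ⟨r, hr, ⟨p⟩⟩ : ∃ r, r = u ∧ G.Reachable a r := ⟨u, rfl, hG a u⟩
  induction p with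
  | nil => exact .inl (hr ▸ .rfl)
  | @cons b c _ hbc p ih =>
    by_cases h : s(b, c) = s(u, v)
    · rcases Sym2.eq_iff.1 h with ⟨rfl, rfl⟩ | ⟨rfl, rfl⟩
      · exact .inl .rfl
      · exact .inr .rfl
    · have hcb : (G.deleteEdges {s(u, v)}).Adj c b := by
        rw [SimpleGraph.deleteEdges_adj, Sym2.eq_swap (a := c)]
        exact ⟨hbc.symm, h⟩
      exact (ih hr).imp (·.trans hcb.reachable) (·.trans hcb.reachable)

/-- The edges of a tree can be mapped injectively to the edges of another tree on the same
vertices so that deleting the image of an edge separates the ends of that edge. -/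
theorem SimpleGraph.IsTree.exists_injective_separating_edge {α : Type*} [Fintype α]
    {T T' : SimpleGraph α} (hT : T.IsTree) (hT' : T'.IsTree) :
    ∃ φ : T.edgeSet → Sym2 α, Function.Injective φ ∧ ∀ e : T.edgeSet, φ e ∈ T'.edgeSet ∧
      ∃ s t, (e : Sym2 α) = s(s, t) ∧ ¬ (T'.deleteEdges {φ e}).Reachable s t := by
  let N : T.edgeSet → Finset (Sym2 α) := fun e => Finset.univ.filter fun e' =>
    e' ∈ T'.edgeSet ∧ ∃ s t, (e : Sym2 α) = s(s, t) ∧ ¬ (T'.deleteEdges {e'}).Reachable s t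
  suffices h : ∀ S : Finset T.edgeSet, S.card ≤ (S.biUnion N).card by
    obtain ⟨φ, hφ, hN⟩ := (Finset.all_card_le_biUnion_card_iff_exists_injective N).1 h
    exact ⟨φ, hφ, fun e => by simpa [N] using hN e⟩
  intro S
  let F : Finset (Sym2 α) := S.map (Function.Embedding.subtype _)
  let K : SimpleGraph α :=
    T.deleteEdges (F : Set (Sym2 α)) ⊔ SimpleGraph.fromEdgeSet (S.biUnion N : Set (Sym2 α))
  have hadj : ∀ s t, T.Adj s t → K.Reachable s t := by
    intro s t hst
    by_cases hF : s(s, t) ∈ F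
    · obtain ⟨p, hp⟩ := hT'.connected.exists_isPath s t
      refine ⟨p.transfer K fun e he => ?_⟩
      have heT' := p.edges_subset_edgeSet he
      have hmem : e ∈ S.biUnion N := by
        refine Finset.mem_biUnion.2 ⟨⟨s(s, t), hst⟩, by simpa [F, hst] using hF, ?_⟩
        exact Finset.mem_filter.2 ⟨Finset.mem_univ _, heT', s, t, rfl,
          hT'.isAcyclic.not_reachable_deleteEdges_of_mem_edges_s19 hp he⟩
      rw [SimpleGraph.edgeSet_sup, SimpleGraph.edgeSet_fromEdgeSet]
      exact .inr ⟨hmem, T'.not_isDiag_of_mem_edgeSet heT'⟩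
    · refine SimpleGraph.Adj.reachable (.inl ?_)
      exact SimpleGraph.deleteEdges_adj.2 ⟨hst, hF⟩
  have hK : K.Connected := by
    have := hT.connected.nonempty
    refine ⟨fun a b => ?_⟩
    obtain ⟨p⟩ := hT.connected a b
    induction p with
    | nil => exact .rfl
    | cons h _ ih => exact (hadj _ _ h).trans ih
  have hcard : Nat.card K.edgeSet ≤ (T.edgeFinset \ F).card + (S.biUnion N).card := by
    refine le_trans ?_ (Finset.card_union_le _ _)
    rw [Nat.card_coe_set_eq, ← Set.ncard_coe_finset]
    refine Set.ncard_le_ncard ?_ (Finset.finite_toSet _)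
    intro e he
    rw [SimpleGraph.edgeSet_sup, SimpleGraph.edgeSet_fromEdgeSet,
      SimpleGraph.edgeSet_deleteEdges] at he
    rcases he with he | he
    · simpa using Or.inl he
    · exact Finset.mem_union_right _ he.1
  have hFT : F ⊆ T.edgeFinset := by
    intro e he
    obtain ⟨e', -, rfl⟩ := Finset.mem_map.1 he
    simp
  have hFS : F.card = S.card := Finset.card_map _
  have hsdiff := Finset.card_sdiff_add_card_eq_card hFT
  have hconn := hK.card_vert_le_card_edgeSet_add_one
  rw [Nat.card_eq_fintype_card, ← hT.card_edgeFinset] at hconn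
  omega

/-- Every vertex lies on the side of an edge of a Gomory–Hu tree whose value is the weight
of that edge. -/
theorem IsGomoryHuTree.apply_sideOf {α : Type*} [Fintype α] {f : Finset α → ℝ}
    {T : SimpleGraph α} {w : Sym2 α → ℝ} (h : IsGomoryHuTree f T w) {e : Sym2 α}
    (he : e ∈ T.edgeSet) (a : α) : f (sideOf T e a) = w e := by
  have side_eq : ∀ {e : Sym2 α} {u : α}, (T.deleteEdges {e}).Reachable u a →
      sideOf T e a = sideOf T e u := fun hu =>
    Finset.filter_congr fun b _ => ⟨hu.trans, hu.symm.trans⟩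
  induction e with
  | _ u v =>
    rcases h.1.connected.preconnected.reachable_deleteEdges_or u v a with hu | hv
    · rw [side_eq hu, (h.2 u v he).1]
    · rw [side_eq hv, Sym2.eq_swap, (h.2 v u he.symm).1]

theorem IsGomoryHuTree.treeEdgeSum_le {α : Type*} [Fintype α] {f : Finset α → ℝ}
    (hf : ∀ S, 0 ≤ f S) {T T' : SimpleGraph α} {w w' : Sym2 α → ℝ}
    (h : IsGomoryHuTree f T w) (h' : IsGomoryHuTree f T' w') :
    treeEdgeSum T w ≤ treeEdgeSum T' w' := by
  obtain ⟨φ, hφ, hsep⟩ := h.1.exists_injective_separating_edge h'.1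
  have hle : ∀ e : T.edgeSet, w e ≤ w' (φ e) := by
    intro e
    obtain ⟨hmem, s, t, hst, hnr⟩ := hsep e
    have hadj : T.Adj s t := by simpa [hst] using e.2
    rw [hst, (h.2 s t hadj).1, ← h'.apply_sideOf hmem s]
    exact (h.2 s t hadj).2 _ (by simp [sideOf]) (by simpa [sideOf] using hnr)
  calc treeEdgeSum T w = ∑ e : T.edgeSet, w e :=
        Finset.sum_subtype _ (fun e => by simp) w
    _ ≤ ∑ e : T.edgeSet, w' (φ e) := Finset.sum_le_sum fun e _ => hle e
    _ = ∑ e' ∈ Finset.univ.map ⟨φ, hφ⟩, w' e' := by simp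
    _ ≤ treeEdgeSum T' w' := by
        refine Finset.sum_le_sum_of_subset_of_nonneg ?_ ?_
        · intro e' he'
          obtain ⟨e, -, rfl⟩ := Finset.mem_map.1 he'
          simpa using (hsep e).1
        · intro e' he' _
          induction e' with
          | _ u v =>
            rw [← h'.apply_sideOf (Finset.mem_filter.1 he').2 u]
            exact hf _

theorem stmt_19 {α : Type*} [Fintype α] [DecidableEq α] {n : ℕ}
    (hn : Fintype.card α = n) (hn2 : 2 ≤ n) (f : Finset α → ℝ)
    (hnn : ∀ S : Finset α, 0 ≤ f S)
    (hsub : ∀ S T : Finset α, f (S ∪ T) + f (S ∩ T) ≤ f S + f T)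
    (hsym : ∀ S : Finset α, f S = f Sᶜ)
    (hzero : f ∅ = 0)
    (T T' : SimpleGraph α) (w w' : Sym2 α → ℝ)
    (hGH : IsGomoryHuTree f T w) (hGH' : IsGomoryHuTree f T' w') :
    treeEdgeSum T w = treeEdgeSum T' w' := by
  exact le_antisymm (hGH.treeEdgeSum_le hnn hGH') (hGH'.treeEdgeSum_le hnn hGH)
end
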